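/- arXiv:1310.1423 — 3 statements merged into one kernel-verified Lean document; each statement's English description precedes it below -/
import Mathlib

section
/- Let Q be a positive definite quadratic form on ℝ^d with determinant Δ. The surface integral over the boundary of the unit cube {x : ‖x‖_∞ = 1} of Q(x)^{-d/2}, with respect to the induced (d-1)-dimensional measure, equals (2/√Δ) · π^{d/2}/Γ(d/2). -/
open MeasureTheory Matrix

/-- The induced `(d-1)`-dimensional measure on the boundary of the cube
`{x : ‖x‖_∞ = 1}`: on each of the `2d` faces `{x : x_j = ±1}` it is the product
Lebesgue measure in the remaining coordinates (restricted to `[-1,1]`). -/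
noncomputable def cubeSurface (d : ℕ) : Measure (Fin d → ℝ) :=
  Measure.sum fun p : Fin d × Bool =>
    Measure.pi fun i =>
      if i = p.1 then Measure.dirac (if p.2 then (1 : ℝ) else -1)
      else volume.restrict (Set.Icc (-1 : ℝ) 1)

/-- The Gaussian integral of a positive definite quadratic form. -/
theorem lintegral_exp_neg_posDef {ι : Type*} [Fintype ι] [DecidableEq ι] {A : Matrix ι ι ℝ}
    (hA : A.PosDef) :
    ∫⁻ x : ι → ℝ, ENNReal.ofReal (Real.exp (-(x ⬝ᵥ A *ᵥ x)))
      = ENNReal.ofReal (Real.pi ^ ((Fintype.card ι : ℝ) / 2) / √A.det) := by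
  have hdet := hA.det_pos
  obtain ⟨B, hB⟩ : ∃ B : Matrix ι ι ℝ, A = Bᵀ * B := by
    open scoped MatrixOrder Matrix.Norms.L2Operator in
    obtain ⟨B, hB⟩ := CStarAlgebra.nonneg_iff_eq_star_mul_self.mp hA.posSemidef.nonneg
    exact ⟨B, by simpa [star_eq_conjTranspose] using hB⟩
  have hdetB : A.det = B.det * B.det := by rw [hB, det_mul, det_transpose]
  have hB0 : B.det ≠ 0 := fun h => by simp [hdetB, h] at hdet
  have hquad : ∀ x : ι → ℝ, x ⬝ᵥ A *ᵥ x = ∑ i, (toLin' B x) i ^ 2 := fun x => by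
    rw [hB, ← mulVec_mulVec, dotProduct_mulVec, vecMul_transpose, toLin'_apply]
    simp [dotProduct, sq]
  have hstd : ∫⁻ x : ι → ℝ, ENNReal.ofReal (Real.exp (-∑ i, x i ^ 2))
      = ENNReal.ofReal (Real.pi ^ ((Fintype.card ι : ℝ) / 2)) := by
    have hexp : ∀ x : ι → ℝ, Real.exp (-∑ i, x i ^ 2) = ∏ i, Real.exp (-1 * x i ^ 2) := fun x => by
      rw [← Real.exp_sum, ← Finset.mul_sum, neg_one_mul]
    simp_rw [hexp]
    have hint : Integrable fun x : ι → ℝ => ∏ i, Real.exp (-1 * x i ^ 2) :=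
      Integrable.fintype_prod (f := fun _ (t : ℝ) => Real.exp (-1 * t ^ 2))
        fun _ => integrable_exp_neg_mul_sq one_pos
    rw [← ofReal_integral_eq_lintegral_ofReal hint
      (ae_of_all _ fun x => by positivity),
      integral_fintype_prod_volume_eq_pow (fun t : ℝ => Real.exp (-1 * t ^ 2)),
      integral_gaussian, div_one, Real.sqrt_eq_rpow, ← Real.rpow_mul_natCast Real.pi_pos.le]
    congr 2
    ring
  have hmeas : Measurable (toLin' B) :=
    (LinearMap.continuous_of_finiteDimensional (toLin' B)).measurable
  simp_rw [hquad]
  rw [← lintegral_map (f := fun y : ι → ℝ => ENNReal.ofReal (Real.exp (-∑ i, y i ^ 2)))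
    (by fun_prop) hmeas, Real.map_matrix_volume_pi_eq_smul_volume_pi hB0,
    lintegral_smul_measure, hstd, smul_eq_mul, ← ENNReal.ofReal_mul (abs_nonneg _), hdetB,
    Real.sqrt_mul_self_eq_abs, abs_inv]
  congr 1
  ring

theorem lintegral_pi_eq_lintegral_insertNth {n : ℕ} (μ : Fin (n + 1) → Measure ℝ)
    [∀ i, SigmaFinite (μ i)] (j : Fin (n + 1)) {g : (Fin (n + 1) → ℝ) → ENNReal}
    (hg : Measurable g) :
    ∫⁻ x, g x ∂Measure.pi μ
      = ∫⁻ t, ∫⁻ y : Fin n → ℝ, g (j.insertNth t y) ∂Measure.pi (fun i => μ (j.succAbove i))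
        ∂μ j := by
  rw [← (measurePreserving_piFinSuccAbove μ j).symm.lintegral_comp_emb
    (MeasurableEquiv.measurableEmbedding _), lintegral_prod _ (by fun_prop)]
  rfl

theorem measurable_insertNth_prod {n : ℕ} (j : Fin (n + 1)) :
    Measurable fun p : ℝ × (Fin n → ℝ) => (j.insertNth p.1 p.2 : Fin (n + 1) → ℝ) :=
  (MeasurableEquiv.piFinSuccAbove (fun _ : Fin (n + 1) => ℝ) j).symm.measurable

theorem lintegral_cubeSurface {n : ℕ} {g : (Fin (n + 1) → ℝ) → ENNReal} (hg : Measurable g) :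
    ∫⁻ x, g x ∂cubeSurface (n + 1)
      = ∑ j : Fin (n + 1), ∑ b : Bool,
        ∫⁻ z in Set.univ.pi fun _ : Fin n => Set.Icc (-1 : ℝ) 1,
          g (j.insertNth (if b then (1 : ℝ) else -1) z) := by
  rw [cubeSurface, lintegral_sum_measure, tsum_fintype, Fintype.sum_prod_type]
  refine Finset.sum_congr rfl fun j _ => Finset.sum_congr rfl fun b _ => ?_
  have hσ : ∀ i : Fin (n + 1), SigmaFinite
      (if i = j then Measure.dirac (if b then (1 : ℝ) else -1)
        else volume.restrict (Set.Icc (-1 : ℝ) 1)) := fun i => by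
    split_ifs <;> infer_instance
  have hgm : Measurable fun t : ℝ => ∫⁻ y : Fin n → ℝ, g (j.insertNth t y)
      ∂Measure.pi (fun _ => volume.restrict (Set.Icc (-1 : ℝ) 1)) :=
    Measurable.lintegral_prod_right' (hg.comp (measurable_insertNth_prod j))
  rw [lintegral_pi_eq_lintegral_insertNth _ j hg]
  simp only [Fin.succAbove_ne, if_false, if_true]
  rw [lintegral_dirac' _ hgm, volume_pi, Measure.restrict_pi_pi]

theorem setLIntegral_abs_le_eq_smul {n : ℕ} {t : ℝ} (ht : 0 < t) {g : (Fin n → ℝ) → ENNReal}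
    (hg : Measurable g) :
    ∫⁻ y in {y : Fin n → ℝ | ∀ i, |y i| ≤ t}, g y
      = ENNReal.ofReal (t ^ n) *
        ∫⁻ z in Set.univ.pi fun _ : Fin n => Set.Icc (-1 : ℝ) 1, g (t • z) := by
  have hS : MeasurableSet {y : Fin n → ℝ | ∀ i, |y i| ≤ t} := by
    simp only [Set.ofPred_forall]
    exact MeasurableSet.iInter fun i => measurableSet_le (by fun_prop) measurable_const
  have hpre : (fun z : Fin n → ℝ => t • z) ⁻¹' {y | ∀ i, |y i| ≤ t}
      = Set.univ.pi fun _ : Fin n => Set.Icc (-1 : ℝ) 1 := by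
    ext z
    have hz : ∀ i, |t * z i| ≤ t ↔ z i ∈ Set.Icc (-1 : ℝ) 1 := fun i => by
      rw [abs_mul, abs_of_pos ht, mul_le_iff_le_one_right ht, abs_le, Set.mem_Icc]
    simp only [Set.mem_preimage, Set.mem_ofPred_eq, Pi.smul_apply, smul_eq_mul, hz,
      Set.mem_univ_pi]
  rw [← hpre, ← setLIntegral_map hS hg (measurable_const_smul t),
    Measure.map_addHaar_smul volume ht.ne', Measure.restrict_smul, lintegral_smul_measure,
    smul_eq_mul, ← mul_assoc, ← ENNReal.ofReal_mul (by positivity),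
    abs_of_pos (by positivity), Module.finrank_fin_fun, mul_inv_cancel₀ (by positivity),
    ENNReal.ofReal_one, one_mul]

theorem lintegral_eq_Ioi_add_Ioi_neg (h : ℝ → ENNReal) :
    ∫⁻ t, h t = (∫⁻ t in Set.Ioi 0, h t) + ∫⁻ t in Set.Ioi 0, h (-t) := by
  have hneg : ∫⁻ t in Set.Ioi (0 : ℝ), h (-t) = ∫⁻ t in Set.Iio 0, h t := by
    have := (Measure.measurePreserving_neg (volume : Measure ℝ)).setLIntegral_comp_preimage_emb
      (MeasurableEquiv.neg ℝ).measurableEmbedding h (Set.Iio 0)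
    simpa using this
  rw [hneg, ← setLIntegral_congr (Iio_ae_eq_Iic (μ := volume) (a := (0 : ℝ))).symm,
    ← lintegral_add_compl h measurableSet_Ioi, Set.compl_Ioi]

/-- The cone of vectors whose `j`-th coordinate has maximal absolute value. -/
def maxCone {n : ℕ} (j : Fin n) : Set (Fin n → ℝ) := {x | ∀ i, |x i| ≤ |x j|}

theorem measurableSet_maxCone {n : ℕ} (j : Fin n) : MeasurableSet (maxCone j) := by
  simp only [maxCone, Set.ofPred_forall]
  exact MeasurableSet.iInter fun i => measurableSet_le (by fun_prop) (by fun_prop)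

theorem iUnion_maxCone (n : ℕ) : ⋃ j : Fin (n + 1), maxCone j = Set.univ :=
  Set.eq_univ_of_forall fun x => Set.mem_iUnion.2 (Finite.exists_max fun i => |x i|)

theorem aedisjoint_maxCone (n : ℕ) :
    Pairwise (Function.onFun (AEDisjoint volume) (maxCone (n := n))) := by
  intro j k hjk
  have hnull : ∀ c : ℝ, volume {x : Fin n → ℝ | x j = c * x k} = 0 := fun c => by
    let L : (Fin n → ℝ) →ₗ[ℝ] ℝ := LinearMap.proj j - c • LinearMap.proj k
    have hL : (LinearMap.ker L : Set (Fin n → ℝ)) = {x | x j = c * x k} := by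
      ext x
      simp [L, sub_eq_zero]
    rw [← hL]
    refine Measure.addHaar_submodule _ _ fun htop => ?_
    have : Pi.single j (1 : ℝ) ∈ LinearMap.ker L := htop ▸ Submodule.mem_top
    simp [L, hjk.symm] at this
  refine measure_mono_null (fun x hx => ?_) (measure_union_null (hnull 1) (hnull (-1)))
  rcases abs_eq_abs.1 (le_antisymm (hx.2 j) (hx.1 k)) with h | h
  · exact Or.inl (by simpa using h)
  · exact Or.inr (by simpa using h)

theorem smul_insertNth {n : ℕ} (j : Fin (n + 1)) (t s : ℝ) (z : Fin n → ℝ) :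
    t • (j.insertNth s z : Fin (n + 1) → ℝ) = j.insertNth (t * s) (t • z) := by
  rw [Fin.eq_insertNth_iff]
  constructor
  · simp
  · ext i
    simp [Fin.removeNth]

theorem setLIntegral_maxCone {n : ℕ} (j : Fin (n + 1)) {f : (Fin (n + 1) → ℝ) → ENNReal}
    (hf : Measurable f) :
    ∫⁻ x in maxCone j, f x
      = ∑ b : Bool, ∫⁻ z in Set.univ.pi fun _ : Fin n => Set.Icc (-1 : ℝ) 1,
        ∫⁻ t in Set.Ioi (0 : ℝ), ENNReal.ofReal (t ^ n) *
          f (t • (j.insertNth (if b then (1 : ℝ) else -1) z : Fin (n + 1) → ℝ)) := by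
  have hslice : ∫⁻ x in maxCone j, f x
      = ∫⁻ t : ℝ, ∫⁻ y in {y : Fin n → ℝ | ∀ i, |y i| ≤ |t|}, f (j.insertNth t y) := by
    rw [← lintegral_indicator (measurableSet_maxCone j), volume_pi,
      lintegral_pi_eq_lintegral_insertNth _ j (hf.indicator (measurableSet_maxCone j))]
    refine lintegral_congr fun t => ?_
    have hS : MeasurableSet {y : Fin n → ℝ | ∀ i, |y i| ≤ |t|} := by
      simp only [Set.ofPred_forall]
      exact MeasurableSet.iInter fun i => measurableSet_le (by fun_prop) measurable_const
    rw [← lintegral_indicator hS, ← volume_pi]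
    refine lintegral_congr fun y => ?_
    simp only [Set.indicator, maxCone, Set.mem_ofPred_eq, Fin.forall_iff_succAbove j,
      Fin.insertNth_apply_same, Fin.insertNth_apply_succAbove, le_refl, true_and]
  have hhalf : ∀ s : ℝ, |s| = 1 →
      ∫⁻ t in Set.Ioi (0 : ℝ),
          ∫⁻ y in {y : Fin n → ℝ | ∀ i, |y i| ≤ |t * s|}, f (j.insertNth (t * s) y)
        = ∫⁻ z in Set.univ.pi fun _ : Fin n => Set.Icc (-1 : ℝ) 1,
          ∫⁻ t in Set.Ioi (0 : ℝ), ENNReal.ofReal (t ^ n) *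
            f (t • (j.insertNth s z : Fin (n + 1) → ℝ)) := fun s hs => by
    have hins : ∀ c : ℝ, Measurable fun y : Fin n → ℝ => (j.insertNth c y : Fin (n + 1) → ℝ) :=
      fun c => (measurable_insertNth_prod j).comp measurable_prodMk_left
    rw [lintegral_lintegral_swap]
    · refine setLIntegral_congr_fun measurableSet_Ioi fun t ht => ?_
      have ht : 0 < t := ht
      simp only [abs_mul, hs, mul_one, abs_of_pos ht]
      rw [setLIntegral_abs_le_eq_smul (g := fun y => f (j.insertNth (t * s) y)) ht
        (hf.comp (hins _)), lintegral_const_mul]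
      · simp_rw [smul_insertNth]
      · exact hf.comp ((hins s).const_smul t)
    · refine Measurable.aemeasurable (Measurable.mul (by fun_prop) (hf.comp ?_))
      exact measurable_snd.smul ((hins s).comp measurable_fst)
  rw [hslice, lintegral_eq_Ioi_add_Ioi_neg, Fintype.sum_bool]
  simpa using congrArg₂ (· + ·) (hhalf 1 (by simp)) (hhalf (-1) (by simp))

/-- Integration in polar coordinates with respect to the cube. -/
theorem lintegral_eq_lintegral_cubeSurface {n : ℕ} {f : (Fin (n + 1) → ℝ) → ENNReal}
    (hf : Measurable f) :
    ∫⁻ x, f x = ∫⁻ y, (∫⁻ t in Set.Ioi (0 : ℝ), ENNReal.ofReal (t ^ n) * f (t • y))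
      ∂cubeSurface (n + 1) := by
  rw [lintegral_cubeSurface, ← setLIntegral_univ, ← iUnion_maxCone,
    lintegral_iUnion₀ (fun j => (measurableSet_maxCone j).nullMeasurableSet)
      (aedisjoint_maxCone _), tsum_fintype]
  · exact Finset.sum_congr rfl fun j _ => setLIntegral_maxCone j hf
  · refine Measurable.lintegral_prod_right' (f := fun p : (Fin (n + 1) → ℝ) × ℝ =>
      ENNReal.ofReal (p.2 ^ n) * f (p.2 • p.1)) (Measurable.mul (by fun_prop) (hf.comp ?_))
    exact measurable_snd.smul measurable_fst

theorem lintegral_Ioi_pow_mul_exp_neg_mul_sq (n : ℕ) {q : ℝ} (hq : 0 < q) :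
    ∫⁻ t in Set.Ioi (0 : ℝ), ENNReal.ofReal (t ^ n) * ENNReal.ofReal (Real.exp (-(t ^ 2 * q)))
      = ENNReal.ofReal (Real.Gamma (((n + 1 : ℕ) : ℝ) / 2) / 2) *
        ENNReal.ofReal (q ^ (-((n + 1 : ℕ) : ℝ) / 2)) := by
  have hn : (-1 : ℝ) < n := by linarith [n.cast_nonneg (α := ℝ)]
  have hΓ : 0 < Real.Gamma (((n + 1 : ℕ) : ℝ) / 2) := Real.Gamma_pos_of_pos (by positivity)
  have hint := integral_rpow_mul_exp_neg_mul_rpow two_pos hn hq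
  rw [← ENNReal.ofReal_mul (by positivity)]
  calc _ = ∫⁻ t in Set.Ioi (0 : ℝ),
        ENNReal.ofReal (t ^ (n : ℝ) * Real.exp (-q * t ^ (2 : ℝ))) := by
        refine setLIntegral_congr_fun measurableSet_Ioi fun t ht => ?_
        have ht : 0 < t := ht
        rw [← ENNReal.ofReal_mul (by positivity), Real.rpow_natCast, Real.rpow_two]
        congr 3
        ring
    _ = _ := by
        rw [← ofReal_integral_eq_lintegral_ofReal
          (integrableOn_rpow_mul_exp_neg_mul_rpow hn two_pos hq)
          ((ae_restrict_mem measurableSet_Ioi).mono fun t ht => by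
            have : (0 : ℝ) < t := ht
            positivity), hint]
        push_cast
        congr 1
        ring

theorem ae_cubeSurface_ne_zero (n : ℕ) : ∀ᵐ x ∂cubeSurface (n + 1), x ≠ 0 := by
  have h0 : MeasurableSet {x : Fin (n + 1) → ℝ | x = 0} := measurableSet_singleton 0
  simp only [ae_iff, not_not]
  rw [← lintegral_indicator_one h0, lintegral_cubeSurface (measurable_one.indicator h0)]
  refine Finset.sum_eq_zero fun j _ => Finset.sum_eq_zero fun b _ => ?_
  have : ∀ z : Fin n → ℝ,
      (j.insertNth (if b then (1 : ℝ) else -1) z : Fin (n + 1) → ℝ) ≠ 0 := fun z hz => by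
    have := congrFun hz j
    cases b <;> simp at this
  simp [Set.indicator, this]

/-- For a positive definite quadratic form `Q(x) = xᵀAx` on `ℝ^d` with determinant `Δ`,
the surface integral of `Q(x)^{-d/2}` over `{x : ‖x‖_∞ = 1}` equals
`(2/√Δ) · π^{d/2}/Γ(d/2)`. -/
theorem stmt3 (d : ℕ) (A : Matrix (Fin d) (Fin d) ℝ) (hA : A.PosDef) :
    (∫ x, (x ⬝ᵥ A.mulVec x) ^ (-(d : ℝ) / 2) ∂(cubeSurface d))
    = 2 / Real.sqrt A.det * (Real.pi ^ ((d : ℝ) / 2) / Real.Gamma ((d : ℝ) / 2)) := by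
  obtain _ | n := d
  · simp [cubeSurface]
  have hpos : ∀ x : Fin (n + 1) → ℝ, x ≠ 0 → 0 < x ⬝ᵥ A *ᵥ x := fun x hx => by
    simpa using (posDef_iff_dotProduct_mulVec.1 hA).2 hx
  have hnonneg : ∀ x : Fin (n + 1) → ℝ, 0 ≤ x ⬝ᵥ A *ᵥ x := fun x => by
    rcases eq_or_ne x 0 with rfl | hx
    · simp
    · exact (hpos x hx).le
  have hQ : Measurable fun x : Fin (n + 1) → ℝ => x ⬝ᵥ A *ᵥ x := by
    simp only [dotProduct, mulVec]
    fun_prop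
  have hΓ : 0 < Real.Gamma (((n + 1 : ℕ) : ℝ) / 2) := Real.Gamma_pos_of_pos (by positivity)
  have hdet := hA.det_pos
  have hpolar := lintegral_exp_neg_posDef hA
  rw [lintegral_eq_lintegral_cubeSurface (by fun_prop)] at hpolar
  have hradial : ∀ᵐ y ∂cubeSurface (n + 1),
      (∫⁻ t in Set.Ioi (0 : ℝ), ENNReal.ofReal (t ^ n) *
        ENNReal.ofReal (Real.exp (-((t • y) ⬝ᵥ A *ᵥ (t • y)))))
      = ENNReal.ofReal (Real.Gamma (((n + 1 : ℕ) : ℝ) / 2) / 2) *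
        ENNReal.ofReal ((y ⬝ᵥ A *ᵥ y) ^ (-((n + 1 : ℕ) : ℝ) / 2)) := by
    filter_upwards [ae_cubeSurface_ne_zero n] with y hy
    rw [← lintegral_Ioi_pow_mul_exp_neg_mul_sq n (hpos y hy)]
    simp only [mulVec_smul, smul_dotProduct, dotProduct_smul, smul_eq_mul, sq, mul_assoc]
  rw [lintegral_congr_ae hradial, lintegral_const_mul _ (by fun_prop), Fintype.card_fin] at hpolar
  rw [integral_eq_lintegral_of_nonneg_ae (ae_of_all _ fun x => Real.rpow_nonneg (hnonneg x) _)
    (hQ.pow_const _).aestronglyMeasurable]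
  have hreal := congrArg ENNReal.toReal hpolar
  rw [ENNReal.toReal_mul, ENNReal.toReal_ofReal (by positivity),
    ENNReal.toReal_ofReal (by positivity)] at hreal
  rw [← mul_right_inj' (half_pos hΓ).ne', hreal]
  field_simp
end

section
/- Let A, B be real d×d matrices with A symmetric positive definite, Q_A(x) = xᵀAx and Q_B(x) = xᵀBx. Then the surface integral over {x : ‖x‖_∞ = 1} of Q_B(x)/Q_A(x)^{1+d/2} with respect to the induced (d-1)-dimensional measure equals tr(BA^{-1})/√(det A) · π^{d/2}/Γ(1 + d/2). -/
open MeasureTheory Matrix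

lemma integrable_pow_mul_exp_neg_sq (a : ℕ) :
    Integrable fun t : ℝ => t ^ a * Real.exp (-t ^ 2) := by
  have h := integrable_rpow_mul_exp_neg_mul_sq one_pos
    (show (-1 : ℝ) < (a : ℝ) by linarith [Nat.cast_nonneg (α := ℝ) a])
  simpa [Real.rpow_natCast] using h

lemma integral_exp_neg_sq : ∫ t : ℝ, Real.exp (-t ^ 2) = √Real.pi := by
  simpa using integral_gaussian 1

lemma integral_mul_exp_neg_sq : ∫ t : ℝ, t * Real.exp (-t ^ 2) = 0 := by
  have h := integral_neg_eq_self (fun t : ℝ => t * Real.exp (-t ^ 2)) volume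
  simp only [neg_sq, neg_mul, integral_neg] at h
  linarith

lemma integral_sq_mul_exp_neg_sq : ∫ t : ℝ, t ^ 2 * Real.exp (-t ^ 2) = √Real.pi / 2 := by
  have h := integral_comp_abs (f := fun t : ℝ => t ^ 2 * Real.exp (-t ^ 2))
  have h2 := integral_rpow_mul_exp_neg_rpow (p := 2) (q := 2) two_pos (by norm_num)
  have h3 : Real.Gamma ((2 + 1) / 2) = √Real.pi / 2 := by
    rw [show ((2 + 1) / 2 : ℝ) = 1 / 2 + 1 by norm_num, Real.Gamma_add_one (by norm_num),
      Real.Gamma_one_half_eq]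
    ring
  simp only [sq_abs] at h
  simp only [Real.rpow_two] at h2
  rw [h, h2, h3]
  ring

section
variable {ι : Type*} [Fintype ι] [DecidableEq ι]

lemma mul_mul_exp_neg_sum_sq_eq_prod (i j : ι) (y : ι → ℝ) :
    y i * y j * Real.exp (-∑ k, y k ^ 2) =
      ∏ k, (y k ^ ((if i = k then 1 else 0) + (if j = k then 1 else 0)) *
        Real.exp (-y k ^ 2)) := by
  rw [Finset.prod_mul_distrib, ← Real.exp_sum, Finset.sum_neg_distrib]
  simp only [pow_add, Finset.prod_mul_distrib, Finset.prod_pow_boole, Finset.mem_univ, if_true]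

lemma integrable_mul_mul_exp_neg_sum_sq (i j : ι) :
    Integrable fun y : ι → ℝ => y i * y j * Real.exp (-∑ k, y k ^ 2) := by
  simp_rw [mul_mul_exp_neg_sum_sq_eq_prod i j]
  exact Integrable.fintype_prod (f := fun k t =>
    t ^ ((if i = k then 1 else 0) + (if j = k then 1 else 0)) * Real.exp (-t ^ 2))
    fun k => integrable_pow_mul_exp_neg_sq _

lemma integral_mul_mul_exp_neg_sum_sq (i j : ι) :
    ∫ y : ι → ℝ, y i * y j * Real.exp (-∑ k, y k ^ 2) =
      if i = j then √Real.pi ^ Fintype.card ι / 2 else 0 := by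
  simp_rw [mul_mul_exp_neg_sum_sq_eq_prod i j]
  rw [integral_fintype_prod_volume_eq_prod (fun k (t : ℝ) =>
    t ^ ((if i = k then 1 else 0) + (if j = k then 1 else 0)) * Real.exp (-t ^ 2))]
  split_ifs with h
  · subst h
    have : ∀ k, (∫ t : ℝ, t ^ ((if i = k then 1 else 0) + (if i = k then 1 else 0)) *
        Real.exp (-t ^ 2)) = √Real.pi * if i = k then 1 / 2 else 1 := by
      intro k
      split_ifs
      · simp [integral_sq_mul_exp_neg_sq]; ring
      · simp [integral_exp_neg_sq]
    simp only [this, Finset.prod_mul_distrib, Finset.prod_ite_eq, Finset.mem_univ, if_true,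
      Finset.prod_const, Finset.card_univ]
    ring
  · apply Finset.prod_eq_zero (Finset.mem_univ i)
    simp [Ne.symm h, integral_mul_exp_neg_sq]

omit [DecidableEq ι] in
lemma dotProduct_mulVec_mul_exp_eq_sum (C : Matrix ι ι ℝ) (y : ι → ℝ) :
    (y ⬝ᵥ C.mulVec y) * Real.exp (-(y ⬝ᵥ y)) =
      ∑ i, ∑ j, C i j * (y i * y j * Real.exp (-∑ k, y k ^ 2)) := by
  simp only [dotProduct, mulVec, Finset.mul_sum, Finset.sum_mul, sq]
  refine Finset.sum_congr rfl fun i _ => Finset.sum_congr rfl fun j _ => by ring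

lemma integrable_dotProduct_mulVec_mul_exp (C : Matrix ι ι ℝ) :
    Integrable fun y : ι → ℝ => (y ⬝ᵥ C.mulVec y) * Real.exp (-(y ⬝ᵥ y)) := by
  simp_rw [dotProduct_mulVec_mul_exp_eq_sum C]
  exact integrable_finsetSum _ fun i _ => integrable_finsetSum _ fun j _ =>
    (integrable_mul_mul_exp_neg_sum_sq i j).const_mul _

lemma integral_dotProduct_mulVec_mul_exp (C : Matrix ι ι ℝ) :
    ∫ y : ι → ℝ, (y ⬝ᵥ C.mulVec y) * Real.exp (-(y ⬝ᵥ y)) =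
      C.trace * (√Real.pi ^ Fintype.card ι / 2) := by
  simp_rw [dotProduct_mulVec_mul_exp_eq_sum C]
  have h (i j : ι) : Integrable fun y : ι → ℝ =>
      C i j * (y i * y j * Real.exp (-∑ k, y k ^ 2)) :=
    (integrable_mul_mul_exp_neg_sum_sq i j).const_mul (C i j)
  rw [integral_finsetSum _ fun i _ => integrable_finsetSum _ fun j _ => h i j]
  simp_rw [integral_finsetSum _ fun j _ => h _ j, integral_const_mul,
    integral_mul_mul_exp_neg_sum_sq]
  simp [Matrix.trace, Finset.sum_mul]

open scoped MatrixOrder in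
lemma Matrix.PosDef.exists_eq_transpose_mul_self {A : Matrix ι ι ℝ} (hA : A.PosDef) :
    ∃ R : Matrix ι ι ℝ, R.det ≠ 0 ∧ A = Rᵀ * R := by
  obtain ⟨R, hR, h⟩ := CStarAlgebra.isStrictlyPositive_iff_eq_star_mul_self.mp
    hA.isStrictlyPositive
  refine ⟨R, ?_, ?_⟩
  · exact ((Matrix.isUnit_iff_isUnit_det R).mp hR).ne_zero
  · rw [h, star_eq_conjTranspose, conjTranspose_eq_transpose_of_trivial]

lemma integrable_and_integral_quadratic_mul_exp {A : Matrix ι ι ℝ} (B : Matrix ι ι ℝ)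
    (hA : A.PosDef) :
    Integrable (fun x : ι → ℝ => (x ⬝ᵥ B.mulVec x) * Real.exp (-(x ⬝ᵥ A.mulVec x))) ∧
    ∫ x : ι → ℝ, (x ⬝ᵥ B.mulVec x) * Real.exp (-(x ⬝ᵥ A.mulVec x)) =
      (B * A⁻¹).trace / √A.det * (√Real.pi ^ Fintype.card ι / 2) := by
  obtain ⟨R, hR, rfl⟩ := hA.exists_eq_transpose_mul_self
  have hu : IsUnit R.det := hR.isUnit
  have hut : IsUnit Rᵀ.det := by rwa [det_transpose]
  set C := (Rᵀ)⁻¹ * B * R⁻¹ with hC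
  have hB : B = Rᵀ * C * R := by
    rw [hC, Matrix.mul_assoc, Matrix.nonsing_inv_mul_cancel_right _ _ hu,
      Matrix.mul_nonsing_inv_cancel_left _ _ hut]
  have htr : (B * (Rᵀ * R)⁻¹).trace = C.trace := by
    rw [Matrix.mul_inv_rev, hC, Matrix.mul_assoc, Matrix.trace_mul_comm (Rᵀ)⁻¹,
      Matrix.mul_assoc]
  have hdet : √(Rᵀ * R).det = |R.det| := by
    rw [det_mul, det_transpose, Real.sqrt_mul_self_eq_abs]
  have hcomp : ∀ M : Matrix ι ι ℝ, ∀ x : ι → ℝ,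
      x ⬝ᵥ (Rᵀ * M * R).mulVec x = (toLin' R x) ⬝ᵥ M.mulVec (toLin' R x) := by
    intro M x
    rw [toLin'_apply, Matrix.mul_assoc, ← mulVec_mulVec, ← mulVec_mulVec, dotProduct_mulVec,
      vecMul_transpose]
  have hfun : (fun x : ι → ℝ => (x ⬝ᵥ B.mulVec x) * Real.exp (-(x ⬝ᵥ (Rᵀ * R).mulVec x))) =
      fun x => (fun y => (y ⬝ᵥ C.mulVec y) * Real.exp (-(y ⬝ᵥ y))) (toLin' R x) := by
    funext x
    have h1 := hcomp 1 x
    rw [Matrix.mul_one, one_mulVec] at h1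
    rw [hB, hcomp, h1]
  have hm := Real.map_matrix_volume_pi_eq_smul_volume_pi hR
  have hmeas : Measurable (toLin' R) := (LinearMap.continuous_of_finiteDimensional _).measurable
  have hint : Integrable (fun y => (y ⬝ᵥ C.mulVec y) * Real.exp (-(y ⬝ᵥ y)))
      (Measure.map (toLin' R) volume) := by
    rw [hm]
    exact (integrable_dotProduct_mulVec_mul_exp C).smul_measure ENNReal.ofReal_ne_top
  rw [hfun]
  refine ⟨hint.comp_measurable hmeas, ?_⟩
  rw [← integral_map hmeas.aemeasurable hint.aestronglyMeasurable, hm, integral_smul_measure,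
    integral_dotProduct_mulVec_mul_exp, htr, hdet, ENNReal.toReal_ofReal (abs_nonneg _), abs_inv]
  simp only [smul_eq_mul]
  ring
end

/-- The sign `±1` attached to a face of the cube. -/
def faceSign (b : Bool) : ℝ := if b then 1 else -1

lemma faceSign_mul_self (b : Bool) : faceSign b * faceSign b = 1 := by
  cases b <;> simp [faceSign]

lemma abs_faceSign (b : Bool) : |faceSign b| = 1 := by
  cases b <;> simp [faceSign]

lemma measurePreserving_faceSign_mul (b : Bool) :
    MeasurePreserving (fun t : ℝ => faceSign b * t) volume volume := by
  cases b
  · simpa [faceSign] using! Measure.measurePreserving_neg (volume : Measure ℝ)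
  · simpa [faceSign] using! MeasurePreserving.id (volume : Measure ℝ)

/-- Product Lebesgue measure on a face of the cube. -/
noncomputable def faceMeasure (d : ℕ) (p : Fin d × Bool) : Measure (Fin d → ℝ) :=
  Measure.pi fun i =>
    if i = p.1 then Measure.dirac (if p.2 then (1 : ℝ) else -1)
    else volume.restrict (Set.Icc (-1 : ℝ) 1)

/-- The cone over a face of the cube, with its apex removed. -/
def faceCone (d : ℕ) (p : Fin d × Bool) : Set (Fin d → ℝ) :=
  {x | 0 < faceSign p.2 * x p.1 ∧ ∀ j, |x j| ≤ faceSign p.2 * x p.1}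

/-- The radial measure `r ^ n dr` on the positive half-line. -/
noncomputable def radialMeasure (n : ℕ) : Measure ℝ :=
  (volume.restrict (Set.Ioi 0)).withDensity fun r => ENNReal.ofReal (r ^ n)

instance (n : ℕ) : SFinite (radialMeasure n) := by
  unfold radialMeasure; infer_instance

instance (d : ℕ) (p : Fin d × Bool) (i : Fin d) : SigmaFinite
    (if i = p.1 then Measure.dirac (if p.2 then (1 : ℝ) else -1)
      else volume.restrict (Set.Icc (-1 : ℝ) 1)) := by
  split_ifs <;> infer_instance

instance (d : ℕ) (p : Fin d × Bool) : SigmaFinite (faceMeasure d p) := by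
  unfold faceMeasure; infer_instance

lemma measurableSet_faceCone (d : ℕ) (p : Fin d × Bool) : MeasurableSet (faceCone d p) := by
  unfold faceCone
  simp only [measurableSet_setOfPred]
  refine Measurable.and ?_ (Measurable.forall fun j => ?_)
  · exact measurableSet_setOfPred.mp (measurableSet_lt (by fun_prop) (by fun_prop))
  · exact measurableSet_setOfPred.mp (measurableSet_le (by fun_prop) (by fun_prop))

lemma measurable_insertNth (n : ℕ) (i : Fin (n + 1)) :
    Measurable fun q : ℝ × (Fin n → ℝ) => (i.insertNth q.1 q.2 : Fin (n + 1) → ℝ) :=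
  (MeasurableEquiv.piFinSuccAbove (fun _ => ℝ) i).symm.measurable

lemma faceMeasure_eq_map (n : ℕ) (i : Fin (n + 1)) (b : Bool) :
    faceMeasure (n + 1) (i, b) =
      Measure.map (fun z : Fin n → ℝ => (i.insertNth (faceSign b) z : Fin (n + 1) → ℝ))
        (volume.restrict (Set.univ.pi fun _ => Set.Icc (-1) 1)) := by
  let μ : Fin (n + 1) → Measure ℝ := fun j =>
    if j = i then Measure.dirac (faceSign b) else volume.restrict (Set.Icc (-1 : ℝ) 1)
  have hμ : ∀ j, SigmaFinite (μ j) := fun j => by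
    dsimp only [μ]; split_ifs <;> infer_instance
  change Measure.pi μ = _
  rw [← (measurePreserving_piFinSuccAbove μ i).symm.map_eq]
  dsimp only [μ]
  simp only [Fin.succAbove_ne, if_true, if_false]
  rw [Measure.dirac_prod, Measure.map_map (MeasurableEquiv.measurable _) (by fun_prop),
    volume_pi, Measure.restrict_pi_pi]
  rfl

lemma lintegral_comp_smul_pi (n : ℕ) {t : ℝ} (ht : 0 < t) {g : (Fin n → ℝ) → ENNReal}
    (hg : Measurable g) :
    ∫⁻ z, g z = ENNReal.ofReal (t ^ n) * ∫⁻ z, g (t • z) := by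
  rw [← lintegral_map hg (measurable_const_smul t), Measure.map_addHaar_smul _ ht.ne',
    lintegral_smul_measure, Module.finrank_fin_fun, smul_eq_mul, ← mul_assoc,
    ← ENNReal.ofReal_mul (by positivity), abs_of_pos (by positivity),
    mul_inv_cancel₀ (by positivity), ENNReal.ofReal_one, one_mul]

lemma smul_insertNth_mem_faceCone_iff (n : ℕ) (i : Fin (n + 1)) (b : Bool) {t : ℝ} (ht : 0 < t)
    (z : Fin n → ℝ) :
    (i.insertNth (faceSign b * t) (t • z) : Fin (n + 1) → ℝ) ∈ faceCone (n + 1) (i, b) ↔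
      z ∈ Set.univ.pi fun _ => Set.Icc (-1 : ℝ) 1 := by
  simp only [faceCone, Set.mem_ofPred_eq, Fin.insertNth_apply_same, ← mul_assoc,
    faceSign_mul_self, one_mul, ht, true_and, Fin.forall_iff_succAbove i, abs_mul, abs_faceSign,
    abs_of_pos ht, le_refl, Fin.insertNth_apply_succAbove, Pi.smul_apply, smul_eq_mul,
    Set.mem_pi, Set.mem_univ, forall_const, Set.mem_Icc, ← abs_le]
  exact forall_congr' fun j => mul_le_iff_le_one_right ht

lemma restrict_faceCone_eq_map (n : ℕ) (p : Fin (n + 1) × Bool) :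
    volume.restrict (faceCone (n + 1) p) =
      Measure.map (fun q : ℝ × (Fin (n + 1) → ℝ) => q.1 • q.2)
        ((radialMeasure n).prod (faceMeasure (n + 1) p)) := by
  obtain ⟨i, b⟩ := p
  have hQ : MeasurableSet (Set.univ.pi fun _ : Fin n => Set.Icc (-1 : ℝ) 1) :=
    MeasurableSet.univ_pi fun _ => measurableSet_Icc
  have hC := measurableSet_faceCone (n + 1) (i, b)
  refine Measure.ext_of_lintegral _ fun f hf => ?_
  have hF : Measurable ((faceCone (n + 1) (i, b)).indicator f) := hf.indicator hC
  have hL : ∫⁻ x in faceCone (n + 1) (i, b), f x =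
      ∫⁻ t : ℝ, ∫⁻ z : Fin n → ℝ,
        (faceCone (n + 1) (i, b)).indicator f (i.insertNth (faceSign b * t) z) := by
    have hG : Measurable fun q : ℝ × (Fin n → ℝ) =>
        (faceCone (n + 1) (i, b)).indicator f (i.insertNth q.1 q.2) :=
      hF.comp (measurable_insertNth n i)
    rw [← lintegral_indicator hC,
      ← (volume_preserving_piFinSuccAbove (fun _ => ℝ) i).symm.lintegral_comp hF]
    refine (lintegral_prod _ hG.aemeasurable).trans ?_
    exact ((measurePreserving_faceSign_mul b).lintegral_comp hG.lintegral_prod_right').symm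
  rw [hL, lintegral_map hf (by fun_prop), lintegral_prod _ (by fun_prop), radialMeasure,
    lintegral_withDensity_eq_lintegral_mul _ (by fun_prop)
      (Measurable.lintegral_prod_right' (f := fun q : ℝ × (Fin (n + 1) → ℝ) => f (q.1 • q.2))
        (by fun_prop)),
    ← lintegral_indicator measurableSet_Ioi]
  refine lintegral_congr fun t => ?_
  have hins (c : ℝ) : Measurable fun z : Fin n → ℝ => (i.insertNth c z : Fin (n + 1) → ℝ) :=
    (measurable_insertNth n i).comp measurable_prodMk_left
  by_cases ht : 0 < t
  · rw [Set.indicator_of_mem (show t ∈ Set.Ioi 0 from ht), Pi.mul_apply, faceMeasure_eq_map,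
      lintegral_map (by fun_prop) (hins _),
      lintegral_comp_smul_pi n ht (g := fun z =>
        (faceCone (n + 1) (i, b)).indicator f (i.insertNth (faceSign b * t) z))
        (hF.comp (hins (faceSign b * t))),
      ← lintegral_indicator hQ]
    congr 1
    refine lintegral_congr fun z => ?_
    have hsm : (i.insertNth (faceSign b * t) (t • z) : Fin (n + 1) → ℝ) =
        t • (i.insertNth (faceSign b) z : Fin (n + 1) → ℝ) := by
      funext j
      refine Fin.succAboveCases i ?_ (fun j => ?_) j
      · simp [mul_comm]
      · simp
    have hiff := smul_insertNth_mem_faceCone_iff n i b ht z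
    by_cases hz : z ∈ Set.univ.pi fun _ => Set.Icc (-1 : ℝ) 1
    · rw [Set.indicator_of_mem hz, Set.indicator_of_mem (hiff.mpr hz), hsm]
    · rw [Set.indicator_of_notMem hz, Set.indicator_of_notMem (fun h => hz (hiff.mp h))]
  · rw [Set.indicator_of_notMem (show t ∉ Set.Ioi 0 from ht)]
    refine (lintegral_congr fun z => ?_).trans lintegral_zero
    refine Set.indicator_of_notMem (fun h => ht ?_) _
    simpa [faceCone, ← mul_assoc, faceSign_mul_self] using h.1

lemma volume_setOf_eq_mul_eq_zero (d : ℕ) {i j : Fin d} (hij : i ≠ j) (c : ℝ) :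
    volume {x : Fin d → ℝ | x i = c * x j} = 0 := by
  let φ : (Fin d → ℝ) →ₗ[ℝ] ℝ := LinearMap.proj i - c • LinearMap.proj j
  have h : LinearMap.ker φ ≠ ⊤ := by
    intro h
    have := LinearMap.congr_fun (LinearMap.ker_eq_top.mp h) (Pi.single i 1)
    simp [φ, hij.symm] at this
  refine measure_mono_null (fun x hx => ?_) (Measure.addHaar_submodule volume _ h)
  simpa [φ, sub_eq_zero] using hx

lemma pairwise_aedisjoint_faceCone (d : ℕ) :
    Pairwise (Function.onFun (AEDisjoint volume) (faceCone d)) := by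
  rintro ⟨i, b⟩ ⟨j, c⟩ hne
  by_cases hij : i = j
  · subst hij
    refine Disjoint.aedisjoint (Set.disjoint_left.mpr fun x hx hy => ?_)
    have h1 := hx.1
    have h2 := hy.1
    cases b <;> cases c <;> simp [faceSign] at hne h1 h2 <;> linarith
  · refine measure_mono_null (fun x hx => ?_)
      (volume_setOf_eq_mul_eq_zero d hij (faceSign b * faceSign c))
    obtain ⟨⟨_, h1⟩, ⟨_, h2⟩⟩ := hx
    have h3 := h1 j
    have h4 := h2 i
    simp only [Set.mem_ofPred_eq] at *
    have e : faceSign b * x i = faceSign c * x j := by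
      apply le_antisymm
      · exact (le_abs_self _).trans (by rwa [abs_mul, abs_faceSign, one_mul])
      · exact (le_abs_self _).trans (by rwa [abs_mul, abs_faceSign, one_mul])
    rw [mul_assoc, ← e, ← mul_assoc, faceSign_mul_self, one_mul]

lemma mem_iUnion_faceCone {d : ℕ} {x : Fin d → ℝ} (hx : x ≠ 0) :
    x ∈ ⋃ p, faceCone d p := by
  obtain ⟨k, hk⟩ := Function.ne_iff.mp hx
  obtain ⟨i, -, hi⟩ := Finset.exists_max_image Finset.univ (fun j => |x j|) ⟨k, Finset.mem_univ k⟩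
  have hpos : 0 < |x i| := (abs_pos.mpr hk).trans_le (hi k (Finset.mem_univ k))
  have hs : faceSign (decide (0 ≤ x i)) * x i = |x i| := by
    by_cases h : 0 ≤ x i
    · simp [faceSign, h, abs_of_nonneg]
    · simp [faceSign, h, abs_of_neg (not_le.mp h)]
  refine Set.mem_iUnion.mpr ⟨(i, decide (0 ≤ x i)), ?_, fun j => ?_⟩
  · simpa only [hs] using hpos
  · simpa only [hs] using hi j (Finset.mem_univ j)

/-- Integration in polar coordinates with respect to the sup norm. -/
lemma map_smul_radialMeasure_prod_cubeSurface (n : ℕ) :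
    Measure.map (fun q : ℝ × (Fin (n + 1) → ℝ) => q.1 • q.2)
      ((radialMeasure n).prod (cubeSurface (n + 1))) = volume := by
  have hcs : cubeSurface (n + 1) = Measure.sum (faceMeasure (n + 1)) := rfl
  have hU : (⋃ p, faceCone (n + 1) p) =ᵐ[volume] Set.univ := by
    rw [ae_eq_univ]
    refine measure_mono_null (fun x hx => ?_) (measure_singleton (0 : Fin (n + 1) → ℝ))
    by_contra h
    exact hx (mem_iUnion_faceCone h)
  rw [hcs, Measure.prod_sum_right, Measure.map_sum (by fun_prop)]
  simp_rw [← restrict_faceCone_eq_map]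
  rw [← Measure.restrict_iUnion_ae (pairwise_aedisjoint_faceCone _)
    fun p => (measurableSet_faceCone _ p).nullMeasurableSet, Measure.restrict_congr_set hU,
    Measure.restrict_univ]

instance (d : ℕ) : SFinite (cubeSurface d) := by
  change SFinite (Measure.sum (faceMeasure d)); infer_instance

lemma integral_radialMeasure_exp (n : ℕ) {a : ℝ} (ha : 0 < a) :
    ∫ r, r ^ 2 * Real.exp (-(r ^ 2 * a)) ∂(radialMeasure n) =
      Real.Gamma (1 + ((n + 1 : ℕ) : ℝ) / 2) / 2 / a ^ (1 + ((n + 1 : ℕ) : ℝ) / 2) := by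
  have h := integral_rpow_mul_exp_neg_mul_rpow (p := 2) (q := ((n + 2 : ℕ) : ℝ)) two_pos
    (by linarith [Nat.cast_nonneg (α := ℝ) (n + 2)]) ha
  have e : (((n + 2 : ℕ) : ℝ) + 1) / 2 = 1 + ((n + 1 : ℕ) : ℝ) / 2 := by push_cast; ring
  rw [neg_div, e, Real.rpow_neg ha.le] at h
  rw [radialMeasure, integral_withDensity_eq_integral_toReal_smul₀ (by fun_prop)
    (Filter.Eventually.of_forall fun _ => ENNReal.ofReal_lt_top)]
  calc _ = ∫ r in Set.Ioi (0 : ℝ), r ^ ((n + 2 : ℕ) : ℝ) * Real.exp (-a * r ^ (2 : ℝ)) := by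
        refine setIntegral_congr_fun measurableSet_Ioi fun r hr => ?_
        have hr' : (0 : ℝ) < r := hr
        simp only [ENNReal.toReal_ofReal (pow_pos hr' n).le, Real.rpow_natCast, Real.rpow_two,
          smul_eq_mul, pow_add, ← mul_assoc]
        congr 2
        ring
    _ = _ := by rw [h]; ring

/-- For real `d×d` matrices `A, B` with `A` symmetric positive definite,
`∫_{‖x‖_∞=1} Q_B(x)/Q_A(x)^{1+d/2} dλ_{d-1} = tr(BA⁻¹)/√(det A) · π^{d/2}/Γ(1+d/2)`. -/
theorem stmt4 (d : ℕ) (A B : Matrix (Fin d) (Fin d) ℝ) (hA : A.PosDef) :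
    (∫ x, (x ⬝ᵥ B.mulVec x) / (x ⬝ᵥ A.mulVec x) ^ (1 + (d : ℝ) / 2) ∂(cubeSurface d))
    = (B * A⁻¹).trace / Real.sqrt A.det * (Real.pi ^ ((d : ℝ) / 2) / Real.Gamma (1 + (d : ℝ) / 2)) := by
  obtain _ | n := d
  · simp [cubeSurface, Matrix.trace]
  obtain ⟨hint, heq⟩ := integrable_and_integral_quadratic_mul_exp B hA
  have hm : Measurable fun q : ℝ × (Fin (n + 1) → ℝ) => q.1 • q.2 := by fun_prop
  have hG : 0 < Real.Gamma (1 + ((n + 1 : ℕ) : ℝ) / 2) := Real.Gamma_pos_of_pos (by positivity)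
  have hpi : √Real.pi ^ (n + 1) = Real.pi ^ (((n + 1 : ℕ) : ℝ) / 2) := by
    rw [Real.sqrt_eq_rpow, ← Real.rpow_natCast, ← Real.rpow_mul Real.pi_pos.le]
    ring_nf
  rw [← map_smul_radialMeasure_prod_cubeSurface n] at hint heq
  rw [integral_map hm.aemeasurable hint.aestronglyMeasurable,
    integral_prod_symm (fun q : ℝ × (Fin (n + 1) → ℝ) => ((q.1 • q.2) ⬝ᵥ B.mulVec (q.1 • q.2)) *
      Real.exp (-((q.1 • q.2) ⬝ᵥ A.mulVec (q.1 • q.2)))) (hint.comp_measurable hm), Fintype.card_fin, hpi] at heq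
  have hinner : ∀ y : Fin (n + 1) → ℝ,
      (∫ r, ((r • y) ⬝ᵥ B.mulVec (r • y)) * Real.exp (-((r • y) ⬝ᵥ A.mulVec (r • y)))
        ∂(radialMeasure n)) = Real.Gamma (1 + ((n + 1 : ℕ) : ℝ) / 2) / 2 *
          ((y ⬝ᵥ B.mulVec y) / (y ⬝ᵥ A.mulVec y) ^ (1 + ((n + 1 : ℕ) : ℝ) / 2)) := by
    intro y
    rcases eq_or_ne y 0 with rfl | hy
    · simp
    have ha : 0 < y ⬝ᵥ A.mulVec y := by simpa using hA.dotProduct_mulVec_pos hy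
    calc _ = ∫ r, (y ⬝ᵥ B.mulVec y) * (r ^ 2 * Real.exp (-(r ^ 2 * (y ⬝ᵥ A.mulVec y))))
          ∂(radialMeasure n) := by
          refine integral_congr_ae (Filter.Eventually.of_forall fun r => ?_)
          simp only [mulVec_smul, smul_dotProduct, dotProduct_smul, smul_eq_mul]
          ring_nf
      _ = _ := by rw [integral_const_mul, integral_radialMeasure_exp n ha]; ring
  simp_rw [hinner] at heq
  rw [integral_const_mul] at heq
  field_simp at heq ⊢
  linarith
end

section
/- The sum Σ_{m=1}^∞ 1/(cosh(2πm) − 1) equals 1/12 − 1/(4π). -/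
open ArithmeticFunction.sigma in
/-- `Σ σ₁(n) qⁿ = Σ q^m / (1 - q^m)²`. -/
lemma tsum_sigma_one_mul_pow {𝕜 : Type*} [RCLike 𝕜] {q : 𝕜} (hq : ‖q‖ < 1) :
    ∑' n : ℕ+, (σ 1 n : 𝕜) * q ^ (n : ℕ) =
      ∑' m : ℕ, q ^ (m + 1) / (1 - q ^ (m + 1)) ^ 2 := by
  rw [← tsum_prod_pow_eq_tsum_sigma 1 hq,
    tsum_pnat_eq_tsum_succ (f := fun d : ℕ ↦ ∑' c : ℕ+, (c : 𝕜) ^ 1 * q ^ (d * c : ℕ))]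
  refine tsum_congr fun m ↦ ?_
  have hqm : ‖q ^ (m + 1)‖ < 1 := by
    rw [norm_pow]
    exact pow_lt_one₀ (norm_nonneg q) hq m.succ_ne_zero
  rw [← tsum_coe_mul_geometric_of_norm_lt_one hqm,
    tsum_pnat_eq_tsum_succ (f := fun c : ℕ ↦ (c : 𝕜) ^ 1 * q ^ ((m + 1) * c)),
    (hasSum_coe_mul_geometric_of_norm_lt_one hqm).summable.tsum_eq_zero_add]
  simp [pow_mul]

/-- The value at `i` of the weight two Eisenstein series `G₂`. -/
lemma EisensteinSeries.G2_I : EisensteinSeries.G2 UpperHalfPlane.I = Real.pi := by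
  have hS : ModularGroup.S • UpperHalfPlane.I = UpperHalfPlane.I := by
    ext
    rw [UpperHalfPlane.modular_S_smul]
    simp
  have h := EisensteinSeries.G2_S_transform UpperHalfPlane.I
  rw [hS, UpperHalfPlane.coe_I, Complex.I_sq, mul_div_cancel_right₀ _ Complex.I_ne_zero] at h
  linear_combination h / 2

lemma tsum_exp_neg_two_pi_div_one_sub_sq :
    ∑' m : ℕ, Real.exp (-(2 * Real.pi)) ^ (m + 1) /
      (1 - Real.exp (-(2 * Real.pi)) ^ (m + 1)) ^ 2 = 1 / 24 - 1 / (8 * Real.pi) := by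
  have hq : Complex.exp (2 * Real.pi * Complex.I * UpperHalfPlane.I) =
      (Real.exp (-(2 * Real.pi)) : ℝ) := by
    simp [mul_assoc]
  have h := EisensteinSeries.G2_eq_tsum_cexp UpperHalfPlane.I
  rw [EisensteinSeries.G2_I, tsum_sigma_one_mul_pow
    (UpperHalfPlane.norm_exp_two_pi_I_lt_one UpperHalfPlane.I), riemannZeta_two, hq] at h
  apply Complex.ofReal_injective
  push_cast at h ⊢
  field_simp at h ⊢
  linear_combination 4 * h

lemma Real.one_div_cosh_sub_one {x : ℝ} (hx : x ≠ 0) :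
    1 / (Real.cosh x - 1) = 2 * (Real.exp (-x) / (1 - Real.exp (-x)) ^ 2) := by
  have h : 1 - Real.exp (-x) ≠ 0 := by
    rw [sub_ne_zero, ne_comm]
    simpa using hx
  have hmul : Real.exp x * Real.exp (-x) = 1 := by rw [← Real.exp_add]; simp
  have hc : Real.cosh x - 1 ≠ 0 := (sub_pos.2 (Real.one_lt_cosh.2 hx)).ne'
  rw [← mul_div_assoc, div_eq_div_iff hc (pow_ne_zero 2 h), Real.cosh_eq]
  linear_combination -hmul

/-- `Σ_{m=1}^∞ 1/(cosh(2πm) − 1) = 1/12 − 1/(4π)`. -/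
theorem stmt19 :
    (∑' m : ℕ, 1 / (Real.cosh (2 * Real.pi * (m + 1)) - 1))
    = 1 / 12 - 1 / (4 * Real.pi) := by
  have h (m : ℕ) : 1 / (Real.cosh (2 * Real.pi * (m + 1)) - 1) =
      2 * (Real.exp (-(2 * Real.pi)) ^ (m + 1) /
        (1 - Real.exp (-(2 * Real.pi)) ^ (m + 1)) ^ 2) := by
    rw [Real.one_div_cosh_sub_one (by positivity), ← Real.exp_nat_mul]
    push_cast
    ring_nf
  rw [tsum_congr h, tsum_mul_left, tsum_exp_neg_two_pi_div_one_sub_sq]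
  ring
end
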